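/- For every 3-god assignment γ and every Boolean b such that γ₁ ≠ ℛ implies (b = true ↔ q'(γ)), where q'(γ) := γ₃ = ℛ ∨ (γ₁ = ℛ ∧ γ₂ = 𝒯 ∧ γ₃ = ℱ): if b = true then γ₂ ≠ ℛ, and if b = false then γ₃ ≠ ℛ. (This shows the alternative balanced first question q' also identifies a non-random god.) -/

import Mathlib

/-- The three god types: truthful (`T`), lying (`F`), random (`R`). -/
inductive GodType where
  | T : GodType
  | F : GodType
  | R : GodType
deriving DecidableEq

open GodType


/-- The alternative balanced first question `q'`. -/
def q' (γ : Fin 3 → GodType) : Prop :=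
  γ 2 = R ∨ (γ 0 = R ∧ γ 1 = T ∧ γ 2 = F)

/-- The alternative balanced first question also identifies a non-random god. -/
theorem q'_finds_nonrandom (γ : Fin 3 → GodType) (hγ : Function.Bijective γ) (b : Bool)
    (hb : γ 0 ≠ R → (b = true ↔ q' γ)) :
    (b = true → γ 1 ≠ R) ∧ (b = false → γ 2 ≠ R) := by
  have h01 : γ 0 ≠ γ 1 := fun h => absurd (hγ.1 h) (by decide)
  have h02 : γ 0 ≠ γ 2 := fun h => absurd (hγ.1 h) (by decide)
  have h12 : γ 1 ≠ γ 2 := fun h => absurd (hγ.1 h) (by decide)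
  constructor
  · intro hbt h1
    have h0 : γ 0 ≠ R := fun h => h01 (h.trans h1.symm)
    rcases (hb h0).1 hbt with h2 | ⟨h, -, -⟩
    · exact h12 (h1.trans h2.symm)
    · exact h0 h
  · intro hbf h2
    have h0 : γ 0 ≠ R := fun h => h02 (h.trans h2.symm)
    have hbt : b = true := (hb h0).2 (Or.inl h2)
    rw [hbf] at hbt
    exact Bool.noConfusion hbt
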